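/- Let c ∈ W be a Coxeter element associated with Π. Then c can be written as c = c₁c₂ with c₁ ∈ W(Π_s) a Coxeter element of W(Π_s) and c₂ ∈ W_l; consequently c^{h_s} ∈ W_l, and h_s divides h, where h_s is the Coxeter number of Δ(Π_s) and h is the Coxeter number of Δ. -/

import Mathlib

open scoped RealInnerProductSpace

/-- The orthogonal reflection of a Euclidean space in the hyperplane orthogonal to `α`
(for `α ≠ 0` this is the usual reflection `x ↦ x - 2(x|α)/(α|α) α`). -/
noncomputable def rrefl {E : Type} [NormedAddCommGroup E] [InnerProductSpace ℝ E]
    [FiniteDimensional ℝ E] (α : E) : E ≃ₗᵢ[ℝ] E :=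
  Submodule.reflection ((ℝ ∙ α)ᗮ)

/-- The group generated by the reflections `r_α` for `α ∈ S`. -/
noncomputable def weylOf {E : Type} [NormedAddCommGroup E] [InnerProductSpace ℝ E]
    [FiniteDimensional ℝ E] (S : Set E) : Subgroup (E ≃ₗᵢ[ℝ] E) :=
  Subgroup.closure (rrefl '' S)

section helpers

variable {E : Type} [NormedAddCommGroup E] [InnerProductSpace ℝ E] [FiniteDimensional ℝ E]

theorem rrefl_apply (α v : E) : rrefl α v = v - (2 * ⟪v, α⟫ / ⟪α, α⟫) • α := by
  unfold rrefl
  rw [Submodule.reflection_orthogonal_apply, Submodule.reflection_singleton_apply]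
  rw [real_inner_self_eq_norm_sq, real_inner_comm, mul_div_assoc, mul_smul, two_smul, two_smul]
  simp

theorem rrefl_mul_self (α : E) : rrefl α * rrefl α = 1 := by
  ext v
  rw [LinearIsometryEquiv.coe_mul, Function.comp_apply, rrefl, Submodule.reflection_reflection]
  rfl

theorem rrefl_inv (α : E) : (rrefl α)⁻¹ = rrefl α :=
  inv_eq_of_mul_eq_one_left (rrefl_mul_self α)

theorem rrefl_self (α : E) : rrefl α α = -α := by
  rw [rrefl_apply]
  by_cases h : α = 0
  · simp [h]
  · have : ⟪α, α⟫ ≠ 0 := by simpa using h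
    rw [mul_div_assoc, div_self this, mul_one, two_smul]
    abel

theorem rrefl_neg (α : E) : rrefl (-α) = rrefl α := by
  ext v
  rw [rrefl_apply, rrefl_apply, inner_neg_right, inner_neg_neg, smul_neg, ← neg_smul]
  congr 2
  ring

theorem rrefl_conj (w : E ≃ₗᵢ[ℝ] E) (α : E) : rrefl (w α) = w * rrefl α * w⁻¹ := by
  rw [eq_mul_inv_iff_mul_eq]
  ext v
  simp only [LinearIsometryEquiv.coe_mul, Function.comp, rrefl_apply,
    LinearIsometryEquiv.inner_map_map, map_sub, map_smul]

theorem rrefl_comm {α β : E} (h : ⟪α, β⟫ = 0) : Commute (rrefl α) (rrefl β) := by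
  have h' : ⟪β, α⟫ = 0 := by rw [real_inner_comm]; exact h
  have e : rrefl α β = β := by rw [rrefl_apply, h']; simp
  have := rrefl_conj (rrefl α) β
  rw [e, eq_mul_inv_iff_mul_eq] at this
  exact this.symm

theorem root_mult {R : Set E} {L : ℝ} (hL : 0 < L) (hn : ∀ γ ∈ R, ‖γ‖ = L)
    (hc : ∀ α ∈ R, ∀ β ∈ R, ∃ n : ℤ, 2 * ⟪β, α⟫ / ⟪α, α⟫ = (n : ℝ))
    {α β : E} (ha : α ∈ R) (hb : β ∈ R) (hne : α ≠ β) (hne' : α ≠ -β) :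
    2 * ⟪β, α⟫ / ⟪α, α⟫ = 0 ∨ 2 * ⟪β, α⟫ / ⟪α, α⟫ = 1 ∨ 2 * ⟪β, α⟫ / ⟪α, α⟫ = -1 := by
  obtain ⟨n, hn'⟩ := hc α ha β hb
  have h1 : 0 < ‖β - α‖ ^ 2 := by
    have : 0 < ‖β - α‖ := norm_pos_iff.2 (sub_ne_zero.2 hne.symm)
    positivity
  have h2 : 0 < ‖β + α‖ ^ 2 := by
    have : 0 < ‖β + α‖ := norm_pos_iff.2 (fun h => hne' (by rw [eq_neg_iff_add_eq_zero, add_comm, h]))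
    positivity
  rw [norm_sub_sq_real, hn _ ha, hn _ hb] at h1
  rw [norm_add_sq_real, hn _ ha, hn _ hb] at h2
  have hLL : 0 < L ^ 2 := by positivity
  have hn2 := hn'
  rw [real_inner_self_eq_norm_sq, hn _ ha, div_eq_iff hLL.ne'] at hn2
  have a1 : (n : ℝ) < 2 := by nlinarith
  have a2 : (-2 : ℝ) < n := by nlinarith
  have b1 : n < 2 := by exact_mod_cast a1
  have b2 : -2 < n := by exact_mod_cast a2
  rw [hn']
  have : n = 0 ∨ n = 1 ∨ n = -1 := by omega
  rcases this with rfl | rfl | rfl <;> simp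

def simpl (R : Set E) (x : E) : Set E :=
  {γ | γ ∈ R ∧ 0 < ⟪x, γ⟫ ∧ ∀ β ∈ R, 0 < ⟪x, β⟫ → ⟪x, rrefl γ β⟫ < 0 → β = γ}

theorem simpl_gen {R : Set E} (hfin : R.Finite) {L : ℝ} (hL : 0 < L) (hn : ∀ γ ∈ R, ‖γ‖ = L)
    (hc : ∀ α ∈ R, ∀ β ∈ R, ∃ n : ℤ, 2 * ⟪β, α⟫ / ⟪α, α⟫ = (n : ℝ))
    (hr : ∀ α ∈ R, ∀ β ∈ R, rrefl α β ∈ R) (x : E) :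
    ∀ γ ∈ R, 0 < ⟪x, γ⟫ → rrefl γ ∈ weylOf (simpl R x) := by
  have hneg : ∀ γ ∈ R, -γ ∈ R := fun γ h => by simpa [rrefl_self] using hr γ h γ h
  by_contra hcon
  push Not at hcon
  let B : Set E := {γ | γ ∈ R ∧ 0 < ⟪x, γ⟫ ∧ rrefl γ ∉ weylOf (simpl R x)}
  have hB : B.Finite := hfin.subset (fun γ h => h.1)
  obtain ⟨γ, ⟨hγ, hγp, hγn⟩, hmin⟩ := Set.exists_min_image B (fun γ => ⟪x, γ⟫) hB
    (by obtain ⟨γ, a, b, c⟩ := hcon; exact ⟨γ, a, b, c⟩)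
  have hγS : γ ∉ simpl R x := fun h => hγn (Subgroup.subset_closure ⟨γ, h, rfl⟩)
  have : ∃ β ∈ R, 0 < ⟪x, β⟫ ∧ ⟪x, rrefl γ β⟫ < 0 ∧ β ≠ γ := by
    by_contra h
    push Not at h
    exact hγS ⟨hγ, hγp, h⟩
  obtain ⟨β, hβ, hβp, hβn, hne⟩ := this
  have hne' : γ ≠ -β := by
    rintro rfl
    simp only [inner_neg_right] at hγp
    linarith
  have hm : 2 * ⟪β, γ⟫ / ⟪γ, γ⟫ = 1 := by
    rcases root_mult hL hn hc hγ hβ hne.symm hne' with h | h | h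
    · rw [rrefl_apply, h] at hβn
      simp at hβn
      linarith
    · exact h
    · rw [rrefl_apply, h] at hβn
      simp [inner_add_right] at hβn
      linarith
  have e1 : rrefl γ β = β - γ := by rw [rrefl_apply, hm, one_smul]
  have hδ : γ - β ∈ R := by
    have := hneg _ (hr γ hγ β hβ)
    rwa [e1, neg_sub] at this
  rw [e1, inner_sub_right] at hβn
  have hδp : 0 < ⟪x, γ - β⟫ := by rw [inner_sub_right]; linarith
  have i1 : rrefl β ∈ weylOf (simpl R x) := by
    by_contra h
    have : ⟪x, γ⟫ ≤ ⟪x, β⟫ := hmin β ⟨hβ, hβp, h⟩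
    linarith
  have i2 : rrefl (γ - β) ∈ weylOf (simpl R x) := by
    by_contra h
    have := hmin (γ - β) ⟨hδ, hδp, h⟩
    simp only [inner_sub_right] at this
    linarith
  have e2 : rrefl β γ = γ - β := by
    have : 2 * ⟪γ, β⟫ / ⟪β, β⟫ = 1 := by
      rw [← hm, real_inner_comm, real_inner_self_eq_norm_sq, real_inner_self_eq_norm_sq, hn _ hγ,
        hn _ hβ]
    rw [rrefl_apply, this, one_smul]
  have e3 := rrefl_conj (rrefl β) γ
  rw [e2] at e3
  have e4 : rrefl γ = (rrefl β)⁻¹ * rrefl (γ - β) * rrefl β := by rw [e3]; group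
  apply hγn
  rw [e4]
  exact mul_mem (mul_mem (inv_mem i1) i2) i1

theorem mem_weylOf_list {S : Set E} {w : E ≃ₗᵢ[ℝ] E} (hw : w ∈ weylOf S) :
    ∃ l : List E, (∀ a ∈ l, a ∈ S) ∧ w = (l.map rrefl).prod := by
  unfold weylOf at hw
  induction hw using Subgroup.closure_induction with
  | mem y hy => obtain ⟨a, ha, rfl⟩ := hy; exact ⟨[a], by simpa using ha, by simp⟩
  | one => exact ⟨[], by simp, by simp⟩
  | mul y z _ _ h1 h2 =>
    obtain ⟨l1, h1, rfl⟩ := h1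
    obtain ⟨l2, h2, rfl⟩ := h2
    refine ⟨l1 ++ l2, ?_, by simp⟩
    intro a ha
    rcases List.mem_append.1 ha with h | h
    · exact h1 a h
    · exact h2 a h
  | inv y _ h1 =>
    obtain ⟨l1, h1, rfl⟩ := h1
    refine ⟨l1.reverse, by simpa using h1, ?_⟩
    rw [List.prod_inv_reverse, List.map_map, List.map_reverse]
    have e : (fun y : E ≃ₗᵢ[ℝ] E => y⁻¹) ∘ rrefl = (rrefl : E → _) := funext rrefl_inv
    rw [e]

theorem rprod_mem {R : Set E} (hr : ∀ α ∈ R, ∀ β ∈ R, rrefl α β ∈ R) :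
    ∀ l : List E, (∀ a ∈ l, a ∈ R) → ∀ β ∈ R, (l.map rrefl).prod β ∈ R := by
  intro l
  induction l with
  | nil => intro _ β h; simpa using h
  | cons a t ih =>
    intro h β hβ
    simp only [List.map_cons, List.prod_cons, LinearIsometryEquiv.coe_mul, Function.comp]
    exact hr _ (h a (by simp)) _ (ih (fun b hb => h b (by simp [hb])) β hβ)

theorem deletion {R : Set E} (hr : ∀ α ∈ R, ∀ β ∈ R, rrefl α β ∈ R) (x : E)
    (hx : ∀ γ ∈ R, ⟪x, γ⟫ ≠ 0) {β : E} (hβ : β ∈ R) (hβp : 0 < ⟪x, β⟫) :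
    ∀ l : List E, (∀ a ∈ l, a ∈ simpl R x) → ⟪x, (l.map rrefl).prod β⟫ < 0 →
      ∃ l' : List E, (∀ a ∈ l', a ∈ simpl R x) ∧ l'.length < l.length ∧
        (l.map rrefl).prod * rrefl β = (l'.map rrefl).prod := by
  intro l
  induction l with
  | nil => intro _ h; simp at h; linarith
  | cons a t ih =>
    intro h hlt
    have ht : ∀ b ∈ t, b ∈ simpl R x := fun b hb => h b (by simp [hb])
    have ha := h a (by simp)
    have hm := rprod_mem hr t (fun b hb => (ht b hb).1) β hβ
    rcases lt_or_gt_of_ne (hx _ hm) with h1 | h1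
    · obtain ⟨l', h1, h2, h3⟩ := ih ht h1
      refine ⟨a :: l', ?_, by simpa using h2, ?_⟩
      · intro b hb
        rcases List.mem_cons.1 hb with rfl | hb
        · exact ha
        · exact h1 b hb
      · simp only [List.map_cons, List.prod_cons, mul_assoc, h3]
    · simp only [List.map_cons, List.prod_cons, LinearIsometryEquiv.coe_mul, Function.comp] at hlt
      have e := ha.2.2 _ hm h1 hlt
      refine ⟨t, ht, by simp, ?_⟩
      have e2 := rrefl_conj (t.map rrefl).prod β
      rw [e] at e2
      simp only [List.map_cons, List.prod_cons]
      rw [e2, inv_mul_cancel_right, mul_assoc, rrefl_mul_self, mul_one]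

theorem trivial_of_pres {R : Set E} (hfin : R.Finite) {L : ℝ} (hL : 0 < L)
    (hn : ∀ γ ∈ R, ‖γ‖ = L)
    (hc : ∀ α ∈ R, ∀ β ∈ R, ∃ n : ℤ, 2 * ⟪β, α⟫ / ⟪α, α⟫ = (n : ℝ))
    (hr : ∀ α ∈ R, ∀ β ∈ R, rrefl α β ∈ R) (x : E)
    (hx : ∀ γ ∈ R, ⟪x, γ⟫ ≠ 0) {w : E ≃ₗᵢ[ℝ] E} (hw : w ∈ weylOf R)
    (hp : ∀ γ ∈ R, 0 < ⟪x, γ⟫ → 0 < ⟪x, w γ⟫) : w = 1 := by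
  have hle : weylOf R ≤ weylOf (simpl R x) := by
    unfold weylOf
    rw [Subgroup.closure_le]
    rintro _ ⟨γ, hγ, rfl⟩
    rcases lt_or_gt_of_ne (hx γ hγ) with h | h
    · rw [← rrefl_neg]
      apply simpl_gen hfin hL hn hc hr
      · simpa [rrefl_self] using hr γ hγ γ hγ
      · simpa using h
    · exact simpl_gen hfin hL hn hc hr x γ hγ h
  obtain ⟨l, hl, rfl⟩ := mem_weylOf_list (hle hw)
  clear hw
  induction hN : l.length using Nat.strong_induction_on generalizing l with
  | _ n ih =>
    rcases List.eq_nil_or_concat l with rfl | ⟨t, a, rfl⟩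
    · simp
    · simp only [List.concat_eq_append] at *
      have ha := hl a (by simp)
      have ht : ∀ b ∈ t, b ∈ simpl R x := fun b hb => hl b (by simp [hb])
      have h1 := hp a ha.1 ha.2.1
      simp [rrefl_self] at h1
      obtain ⟨l', h1, h2, h3⟩ := deletion hr x hx ha.1 ha.2.1 t ht h1
      have e : ((t ++ [a]).map rrefl).prod = (l'.map rrefl).prod := by simpa using h3
      rw [e] at hp ⊢
      exact ih l'.length (by simp at hN; omega) l' h1 hp rfl

inductive CE {α : Type} (C : α → α → Prop) : List α → List α → Prop
  | refl (a) : CE C a a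
  | symm {a b} : CE C a b → CE C b a
  | trans {a b c} : CE C a b → CE C b c → CE C a c
  | rot (x a) : CE C (x :: a) (a ++ [x])
  | swap (p x y q) : C x y → CE C (p ++ x :: y :: q) (p ++ y :: x :: q)

theorem CE.perm {α : Type} {C : α → α → Prop} {a b : List α} (h : CE C a b) : a.Perm b := by
  induction h with
  | refl a => exact List.Perm.refl _
  | symm _ ih => exact ih.symm
  | trans _ _ h1 h2 => exact h1.trans h2
  | rot x a => exact (List.perm_append_singleton x a).symm
  | swap p x y q _ => exact List.Perm.append_left p (List.Perm.swap y x q)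

theorem CE.isConj {α G : Type} [Group G] {C : α → α → Prop} (r : α → G)
    (hC : ∀ x y, C x y → Commute (r x) (r y)) {a b : List α} (h : CE C a b) :
    IsConj (a.map r).prod (b.map r).prod := by
  induction h with
  | refl a => exact IsConj.refl _
  | symm _ ih => exact ih.symm
  | trans _ _ h1 h2 => exact h1.trans h2
  | rot x a =>
    rw [isConj_iff]
    refine ⟨(r x)⁻¹, ?_⟩
    simp
  | swap p x y q hxy =>
    have := (hC x y hxy).eq
    have e : ((p ++ x :: y :: q).map r).prod = ((p ++ y :: x :: q).map r).prod := by
      simp only [List.map_append, List.map_cons, List.prod_append, List.prod_cons]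
      rw [← mul_assoc (r x), this, mul_assoc]
    rw [e]

theorem CE.move {α : Type} {C : α → α → Prop} (v : α) (a q : List α) (h : ∀ x ∈ a, C v x) :
    CE C (v :: a ++ q) (a ++ v :: q) := by
  suffices H : ∀ p, CE C (p ++ (v :: a ++ q)) (p ++ (a ++ v :: q)) from H []
  induction a with
  | nil => intro p; exact CE.refl _
  | cons x t ih =>
    intro p
    have h1 := CE.swap (C := C) p v x (t ++ q) (h x (by simp))
    have h2 := ih (fun y hy => h y (by simp [hy])) (p ++ [x])
    simp only [List.append_assoc, List.cons_append, List.nil_append] at h1 h2 ⊢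
    exact h1.trans h2

theorem CE.rotate {α : Type} {C : α → α → Prop} (a b : List α) : CE C (a ++ b) (b ++ a) := by
  induction a generalizing b with
  | nil => simpa using CE.refl b
  | cons x t ih =>
    have h1 := CE.rot (C := C) x (t ++ b)
    have h2 := ih (b ++ [x])
    simp only [List.append_assoc, List.cons_append, List.nil_append] at h1 h2 ⊢
    exact h1.trans h2

theorem CE.cons {α : Type} {C : α → α → Prop} (v : α) {a b : List α}
    (h : CE C a b) (hnd : a.Nodup)
    (hv : ∀ x ∈ a, ∀ y ∈ a, ¬ C v x → ¬ C v y → x = y) : CE C (v :: a) (v :: b) := by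
  induction h with
  | refl a => exact CE.refl _
  | @symm a b h ih =>
    have hp := h.perm
    exact (ih (hp.nodup_iff.2 hnd)
      (fun x hx y hy => hv x (hp.mem_iff.1 hx) y (hp.mem_iff.1 hy))).symm
  | @trans a b c h1 h2 ih1 ih2 =>
    have hp := h1.perm
    exact (ih1 hnd hv).trans (ih2 (hp.nodup_iff.1 hnd)
      (fun x hx y hy => hv x (hp.mem_iff.2 hx) y (hp.mem_iff.2 hy)))
  | rot x a =>
    by_cases hx : C v x
    · have h1 := CE.swap (C := C) [] v x a hx
      have h2 := CE.rot (C := C) x (v :: a)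
      exact h1.trans h2
    · have h1 := CE.move (C := C) v a [x] (by
        intro y hy
        by_contra hy'
        have := hv x (by simp) y (by simp [hy]) hx hy'
        subst this
        exact (List.nodup_cons.1 hnd).1 hy)
      have h2 := CE.rotate (C := C) a [v, x]
      exact (h1.trans h2).symm
  | swap p x y q hxy => exact CE.swap (v :: p) x y q hxy

theorem CE.of_perm {α : Type} {C : α → α → Prop} (n : ℕ) : ∀ (a b : List α), a.length = n →
    a.Nodup → a.Perm b →
    (∀ s : List α, s.Nodup → s ≠ [] → (∀ x ∈ s, x ∈ a) →
      ∃ v ∈ s, ∀ x ∈ s, ∀ y ∈ s, x ≠ v → y ≠ v → ¬ C v x → ¬ C v y → x = y) → CE C a b := by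
  induction n with
  | zero =>
    intro a b hl _ hp _
    have : a = [] := List.length_eq_zero_iff.1 hl
    subst this
    rw [List.nil_perm.1 hp]
    exact CE.refl _
  | succ n ih =>
    intro a b hl hnd hp hleaf
    obtain ⟨v, hva, hv⟩ := hleaf a hnd (by rintro rfl; simp at hl) (fun x h => h)
    obtain ⟨p, q, rfl⟩ := List.append_of_mem hva
    obtain ⟨p', q', rfl⟩ := List.append_of_mem (hp.mem_iff.1 hva)
    have h1 := CE.rotate (C := C) p (v :: q)
    have h2 := CE.rotate (C := C) p' (v :: q')
    simp only [List.cons_append] at h1 h2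
    have hp2 : (v :: (q ++ p)).Perm (v :: (q' ++ p')) := (h1.perm.symm.trans hp).trans h2.perm
    have hnd2 : (v :: (q ++ p)).Nodup := h1.perm.nodup_iff.1 hnd
    have hsub : ∀ x ∈ q ++ p, x ∈ p ++ v :: q := fun x hx =>
      h1.perm.mem_iff.2 (List.mem_cons_of_mem _ hx)
    have hne : ∀ x ∈ q ++ p, x ≠ v := by
      rintro x hx rfl
      exact (List.nodup_cons.1 hnd2).1 hx
    have h3 : CE C (q ++ p) (q' ++ p') := by
      refine ih _ _ ?_ (List.nodup_cons.1 hnd2).2 (List.perm_cons _ |>.1 hp2) ?_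
      · simp at hl ⊢; omega
      · intro s hs hs0 hsa
        exact hleaf s hs hs0 (fun x hx => hsub x (hsa x hx))
    have h4 := CE.cons v h3 (List.nodup_cons.1 hnd2).2
      (fun x hx y hy => hv x (hsub x hx) y (hsub y hy) (hne x hx) (hne y hy))
    exact (h1.trans h4).trans h2.symm

theorem exists_dual {Φ : Set E} (hΦind : LinearIndependent ℝ (fun a : Φ => (a : E)))
    (f : E → ℝ) : ∃ y : E, ∀ α ∈ Φ, ⟪y, α⟫ = f α := by
  let B := Module.Basis.extend hΦind.linearIndepOn_id
  let φ : E →ₗ[ℝ] ℝ := B.constr ℝ (fun i => f i)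
  refine ⟨(InnerProductSpace.toDual ℝ E).symm φ.toContinuousLinearMap, ?_⟩
  intro α hα
  rw [InnerProductSpace.toDual_symm_apply]
  have hm : α ∈ hΦind.linearIndepOn_id.extend (Set.subset_univ _) :=
    hΦind.linearIndepOn_id.subset_extend _ (by simpa using hα)
  have := B.constr_basis ℝ (fun i => f i) ⟨α, hm⟩
  rw [Module.Basis.extend_apply_self] at this
  exact this

theorem exists_leaf {Φs : Set E} {k : ℝ} (hk : 0 < k)
    (hind : LinearIndependent ℝ (fun a : Φs => (a : E)))
    (hself : ∀ a ∈ Φs, ⟪a, a⟫ = k)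
    (hoff : ∀ a ∈ Φs, ∀ b ∈ Φs, a ≠ b → ⟪a, b⟫ = 0 ∨ ⟪a, b⟫ = -(k / 2))
    (s : Finset E) (hs : s.Nonempty) (hsub : ∀ x ∈ s, x ∈ Φs) :
    ∃ v ∈ s, ∀ x ∈ s, ∀ y ∈ s, x ≠ v → y ≠ v → ¬ ⟪v, x⟫ = 0 → ¬ ⟪v, y⟫ = 0 → x = y := by
  classical
  by_contra hcon
  push Not at hcon
  have key : ∀ v ∈ s, ⟪v, ∑ u ∈ s, u⟫ ≤ 0 := by
    intro v hv
    obtain ⟨x, hx, y, hy, hxv, hyv, hx0, hy0, hxy⟩ := hcon v hv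
    rw [inner_sum, ← Finset.add_sum_erase s _ hv,
      ← Finset.add_sum_erase (s.erase v) _ (Finset.mem_erase.2 ⟨hxv, hx⟩),
      ← Finset.add_sum_erase ((s.erase v).erase x) _
        (Finset.mem_erase.2 ⟨hxy.symm, Finset.mem_erase.2 ⟨hyv, hy⟩⟩)]
    have h1 := (hoff v (hsub v hv) x (hsub x hx) hxv.symm).resolve_left hx0
    have h2 := (hoff v (hsub v hv) y (hsub y hy) hyv.symm).resolve_left hy0
    have h3 : ∑ u ∈ ((s.erase v).erase x).erase y, ⟪v, u⟫ ≤ 0 := by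
      apply Finset.sum_nonpos
      intro u hu
      simp only [Finset.mem_erase] at hu
      rcases hoff v (hsub v hv) u (hsub u hu.2.2.2) hu.2.2.1.symm with h | h <;> rw [h]
      linarith
    rw [hself v (hsub v hv), h1, h2]
    linarith
  have h0 : ⟪∑ v ∈ s, v, ∑ u ∈ s, u⟫ ≤ 0 := by
    rw [sum_inner]
    exact Finset.sum_nonpos key
  have h1 : ∑ v ∈ s, v = 0 := by
    rw [← inner_self_eq_zero (𝕜 := ℝ)]
    exact le_antisymm h0 real_inner_self_nonneg
  obtain ⟨y, hy⟩ := exists_dual hind (fun _ => 1)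
  have h2 : ⟪y, ∑ v ∈ s, v⟫ = (s.card : ℝ) := by
    rw [inner_sum, Finset.sum_congr rfl (fun v hv => hy v (hsub v hv))]
    simp
  rw [h1, inner_zero_right] at h2
  have := hs.card_pos
  have h3 : s.card = 0 := by exact_mod_cast h2.symm
  omega

theorem norm_step {Δ Δl : Set E} {ll : ℝ} (hrefl : ∀ α ∈ Δ, ∀ β ∈ Δ, rrefl α β ∈ Δ)
    (hΔl : Δl = {α ∈ Δ | ‖α‖ = ll}) : ∀ l : List E, (∀ a ∈ l, a ∈ Δ) → ∀ g ∈ weylOf Δl,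
      (l.map rrefl).prod⁻¹ * g * (l.map rrefl).prod ∈ weylOf Δl := by
  have h1 : ∀ a ∈ Δ, ∀ g ∈ weylOf Δl, (rrefl a)⁻¹ * g * rrefl a ∈ weylOf Δl := by
    intro a ha g hg
    unfold weylOf at hg
    induction hg using Subgroup.closure_induction with
    | mem y hy =>
      obtain ⟨b, hb, rfl⟩ := hy
      have e := rrefl_conj (rrefl a) b
      rw [rrefl_inv] at e
      rw [rrefl_inv, ← e]
      refine Subgroup.subset_closure ⟨_, ?_, rfl⟩
      rw [hΔl] at hb ⊢
      exact ⟨hrefl a ha b hb.1, by rw [LinearIsometryEquiv.norm_map]; exact hb.2⟩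
    | one => simp [one_mem]
    | mul y z _ _ h1 h2 =>
      have := mul_mem h1 h2
      convert this using 1
      group
    | inv y _ h1 =>
      have := inv_mem h1
      convert this using 1
      group
  intro l
  induction l with
  | nil => intro _ g hg; simpa using hg
  | cons a t ih =>
    intro h g hg
    have := ih (fun b hb => h b (by simp [hb])) _ (h1 a (h a (by simp)) g hg)
    convert this using 1
    simp only [List.map_cons, List.prod_cons]
    group

theorem factor {Δ Δs Δl Φ : Set E} {ll : ℝ} (hrefl : ∀ α ∈ Δ, ∀ β ∈ Δ, rrefl α β ∈ Δ)
    (hΔl : Δl = {α ∈ Δ | ‖α‖ = ll}) (hcover : Δ = Δs ∪ Δl) :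
    ∀ l : List E, l.Nodup → (∀ a ∈ l, a ∈ Δ) → ∃ m : List E, m.Nodup ∧
      (∀ x, x ∈ m ↔ x ∈ l ∧ x ∈ Δs) ∧
      ∃ c₂ ∈ weylOf Δl, (l.map rrefl).prod = (m.map rrefl).prod * c₂ := by
  classical
  intro l hnd hl
  refine ⟨l.filter (fun x => x ∈ Δs), hnd.filter _, by simp, ?_⟩
  clear hnd
  induction l with
  | nil => exact ⟨1, one_mem _, by simp⟩
  | cons a t ih =>
    obtain ⟨c, hc, e⟩ := ih (fun b hb => hl b (by simp [hb]))
    by_cases ha : a ∈ Δs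
    · refine ⟨c, hc, ?_⟩
      simp [ha, e, mul_assoc]
    · have ha' : a ∈ Δl := by
        have := hl a (by simp)
        rw [hcover] at this
        exact this.resolve_left ha
      have hn := norm_step hrefl hΔl (t.filter (fun x => x ∈ Δs))
        (fun b hb => hl b (by simp at hb; simp [hb])) (rrefl a)
        (Subgroup.subset_closure ⟨a, ha', rfl⟩)
      refine ⟨_, mul_mem hn hc, ?_⟩
      simp only [List.map_cons, List.prod_cons, e, ha, decide_false, Bool.false_eq_true,
        not_false_eq_true, List.filter_cons_of_neg]
      group

theorem pow_factor {H : Subgroup (E ≃ₗᵢ[ℝ] E)} {c d : E ≃ₗᵢ[ℝ] E} (hd : d ∈ H)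
    (hn : ∀ g ∈ H, c⁻¹ * g * c ∈ H) (n : ℕ) : ∃ e ∈ H, (c * d) ^ n = c ^ n * e := by
  induction n with
  | zero => exact ⟨1, one_mem _, by simp⟩
  | succ n ih =>
    obtain ⟨e, he, h⟩ := ih
    refine ⟨_, mul_mem (hn e he) hd, ?_⟩
    rw [pow_succ, h, pow_succ]
    group

end helpers

/-- Let `c ∈ W` be a Coxeter element associated with `Π`. Then `c = c₁c₂`
with `c₁ ∈ W(Πs)` a Coxeter element of `W(Πs)` and `c₂ ∈ W_l`; consequently `c^{h_s} ∈ W_l`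
and `h_s ∣ h`, where `h_s` is the Coxeter number of `Δ(Πs)` and `h` that of `Δ`. -/
theorem statement18
    {E : Type} [NormedAddCommGroup E] [InnerProductSpace ℝ E] [FiniteDimensional ℝ E]
    (Δ Δs Δl Δp Φ Φs : Set E)
    -- `Δ` is a finite set of nonzero vectors spanning `E`
    (hfin : Δ.Finite) (h0 : (0 : E) ∉ Δ)
    (hspan : Submodule.span ℝ Δ = ⊤)
    -- stable under all root reflections
    (hrefl : ∀ α ∈ Δ, ∀ β ∈ Δ, rrefl α β ∈ Δ)
    -- crystallographic
    (hcrys : ∀ α ∈ Δ, ∀ β ∈ Δ, ∃ n : ℤ, 2 * ⟪β, α⟫ / ⟪α, α⟫ = (n : ℝ))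
    -- reduced
    (hred : ∀ α ∈ Δ, ∀ t : ℝ, t • α ∈ Δ → t = 1 ∨ t = -1)
    -- irreducible
    (hirr : ∀ A B : Set E, A ∪ B = Δ → (∀ a ∈ A, ∀ b ∈ B, ⟪a, b⟫ = 0) → A = ∅ ∨ B = ∅)
    -- two root lengths: `Δs` are the short roots, `Δl` the long ones
    (ls ll : ℝ) (h0ls : 0 < ls) (hlsll : ls < ll)
    (hΔs : Δs = {α ∈ Δ | ‖α‖ = ls}) (hΔl : Δl = {α ∈ Δ | ‖α‖ = ll})
    (hcover : Δ = Δs ∪ Δl) (hsne : Δs.Nonempty) (hlne : Δl.Nonempty)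
    -- `Δp` is a positive system: for each root exactly one of `±α` is positive
    (hΔpΔ : Δp ⊆ Δ) (hpm : ∀ α ∈ Δ, α ∈ Δp ↔ -α ∉ Δp)
    -- `Φ` is the corresponding set of simple roots, `Φs = Φ ∩ Δs` the short simple roots
    (hΦp : Φ ⊆ Δp)
    (hΦind : LinearIndependent ℝ (fun a : Φ => (a : E)))
    (hΦdec : ∀ γ ∈ Δp, ∃ c : E →₀ ℕ, ↑c.support ⊆ Φ ∧ γ = c.sum fun α n => (n : ℝ) • α)
    (hΦs : Φs = Φ ∩ Δs)
    -- `h` is the Coxeter number: the order of a Coxeter element, i.e. of the product of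
    -- all simple reflections (in some order)
    (lΦ : List E) (hlnd : lΦ.Nodup) (hlset : {x | x ∈ lΦ} = Φ)
    (h : ℕ) (hcox : h = orderOf ((lΦ.map rrefl).prod))
    -- `hs` is the Coxeter number of the subsystem `Δ(Πs)` generated by the short simple
    -- roots: the order of a Coxeter element of its Weyl group `W(Πs)`
    (lΦs : List E) (hlnds : lΦs.Nodup) (hlsets : {x | x ∈ lΦs} = Φs)
    (hs : ℕ) (hcoxs : hs = orderOf ((lΦs.map rrefl).prod))
 :
    (∃ c₁ c₂ : E ≃ₗᵢ[ℝ] E,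
      (∃ m : List E, m.Nodup ∧ {x | x ∈ m} = Φs ∧ c₁ = (m.map rrefl).prod) ∧
      c₂ ∈ weylOf Δl ∧ (lΦ.map rrefl).prod = c₁ * c₂) ∧
    (lΦ.map rrefl).prod ^ hs ∈ weylOf Δl ∧
    hs ∣ h := by
  classical
  have hΦΔ : ∀ a ∈ Φ, a ∈ Δ := fun a ha => hΔpΔ (hΦp ha)
  have hΦsΦ : ∀ a ∈ Φs, a ∈ Φ := fun a ha => by rw [hΦs] at ha; exact ha.1
  have hΦsS : ∀ a ∈ Φs, a ∈ Δs := fun a ha => by rw [hΦs] at ha; exact ha.2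
  have hmΦ : ∀ a, a ∈ lΦ ↔ a ∈ Φ := fun a => by rw [← hlset]; rfl
  have hmΦs : ∀ a, a ∈ lΦs ↔ a ∈ Φs := fun a => by rw [← hlsets]; rfl
  have hsn : ∀ a ∈ Δs, ‖a‖ = ls := fun a ha => by rw [hΔs] at ha; exact ha.2
  have hsΔ : ∀ a ∈ Δs, a ∈ Δ := fun a ha => by rw [hΔs] at ha; exact ha.1
  have hln : ∀ a ∈ Δl, ‖a‖ = ll := fun a ha => by rw [hΔl] at ha; exact ha.2
  have hlΔ : ∀ a ∈ Δl, a ∈ Δ := fun a ha => by rw [hΔl] at ha; exact ha.1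
  have hlr : ∀ a ∈ Δ, ∀ b ∈ Δl, rrefl a b ∈ Δl := by
    intro a ha b hb
    rw [hΔl] at hb ⊢
    exact ⟨hrefl a ha b hb.1, by rw [LinearIsometryEquiv.norm_map]; exact hb.2⟩
  -- nonnegativity of dual vectors on positive roots
  have hinner : ∀ (y γ : E) (c : E →₀ ℕ), γ = c.sum (fun α n => (n : ℝ) • α) →
      ⟪y, γ⟫ = ∑ α ∈ c.support, (c α : ℝ) * ⟪y, α⟫ := by
    rintro y γ c rfl
    rw [Finsupp.sum, inner_sum]
    exact Finset.sum_congr rfl (fun α _ => by rw [inner_smul_right])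
  have hnonneg : ∀ y : E, (∀ α ∈ Φ, 0 ≤ ⟪y, α⟫) → ∀ γ ∈ Δp, 0 ≤ ⟪y, γ⟫ := by
    intro y hy γ hγ
    obtain ⟨c, hc, e⟩ := hΦdec γ hγ
    rw [hinner y γ c e]
    exact Finset.sum_nonneg (fun α hα => mul_nonneg (Nat.cast_nonneg _) (hy α (hc hα)))
  have hneg : ∀ γ ∈ Δ, -γ ∈ Δ := fun γ hγ => by simpa [rrefl_self] using hrefl γ hγ γ hγ
  -- the height vector
  obtain ⟨x, hx⟩ := exists_dual hΦind (fun _ => 1)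
  have hxpos : ∀ γ ∈ Δp, 0 < ⟪x, γ⟫ := by
    intro γ hγ
    obtain ⟨c, hc, e⟩ := hΦdec γ hγ
    rw [hinner x γ c e]
    apply Finset.sum_pos
    · intro α hα
      rw [hx α (hc hα), mul_one]
      exact_mod_cast Nat.pos_of_ne_zero (Finsupp.mem_support_iff.1 hα)
    · by_contra hne
      rw [Finset.not_nonempty_iff_eq_empty, Finsupp.support_eq_empty] at hne
      rw [hne] at e
      exact h0 (by rw [Finsupp.sum_zero_index] at e; rw [← e]; exact hΔpΔ hγ)
  have hpos_mem : ∀ y : E, (∀ α ∈ Φ, 0 ≤ ⟪y, α⟫) → ∀ γ ∈ Δ, 0 < ⟪y, γ⟫ → γ ∈ Δp := by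
    intro y hy γ hγ hlt
    rw [hpm γ hγ]
    intro hmem
    have := hnonneg y hy _ hmem
    rw [inner_neg_right] at this
    linarith
  have hx0 : ∀ α ∈ Φ, 0 ≤ ⟪x, α⟫ := fun α hα => by rw [hx α hα]; norm_num
  have hxne : ∀ γ ∈ Δ, ⟪x, γ⟫ ≠ 0 := by
    intro γ hγ
    by_cases hp : γ ∈ Δp
    · exact (hxpos γ hp).ne'
    · have : -γ ∈ Δp := by
        by_contra hq
        exact hp ((hpm γ hγ).2 hq)
      have := hxpos _ this
      rw [inner_neg_right] at this
      intro h
      linarith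
  -- short simple reflections preserve positive long roots
  have hpres1 : ∀ α ∈ Φs, ∀ γ ∈ Δl, 0 < ⟪x, γ⟫ → 0 < ⟪x, rrefl α γ⟫ := by
    intro α hα γ hγ hγp
    have hγΔp := hpos_mem x hx0 γ (hlΔ γ hγ) hγp
    obtain ⟨y, hy⟩ := exists_dual hΦind (fun β => if β = α then 0 else 1)
    have hyn : ∀ β ∈ Φ, 0 ≤ ⟪y, β⟫ := fun β hβ => by rw [hy β hβ]; split_ifs <;> norm_num
    have hyα : ⟪y, α⟫ = 0 := by rw [hy α (hΦsΦ α hα)]; simp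
    have hyγ : 0 < ⟪y, γ⟫ := by
      refine lt_of_le_of_ne (hnonneg y hyn γ hγΔp) ?_
      intro hz
      obtain ⟨c, hc, e⟩ := hΦdec γ hγΔp
      rw [hinner y γ c e, eq_comm, Finset.sum_eq_zero_iff_of_nonneg
        (fun β hβ => mul_nonneg (Nat.cast_nonneg _) (hyn β (hc hβ)))] at hz
      have hsupp : c.support ⊆ {α} := by
        intro β hβ
        have h1 := hz β hβ
        rw [hy β (hc hβ)] at h1
        have h2 : (c β : ℝ) ≠ 0 := by exact_mod_cast Finsupp.mem_support_iff.1 hβ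
        by_contra h3
        rw [Finset.mem_singleton] at h3
        simp [h3] at h1
        exact h2 (by exact_mod_cast h1)
      rw [Finsupp.sum_of_support_subset c hsupp _ (by simp), Finset.sum_singleton] at e
      have h1 := hred α (hΦΔ α (hΦsΦ α hα)) (c α) (by rw [← e]; exact hlΔ γ hγ)
      have h2 := hln γ hγ
      have h3 := hsn α (hΦsS α hα)
      rw [e, norm_smul, h3] at h2
      rcases h1 with h1 | h1 <;> rw [h1] at h2 <;> simp at h2 <;> linarith
    have hm : rrefl α γ ∈ Δp := by
      apply hpos_mem y hyn _ (hlΔ _ (hlr α (hΦΔ α (hΦsΦ α hα)) γ hγ))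
      rw [rrefl_apply, inner_sub_right, inner_smul_right, hyα]
      simpa using hyγ
    exact hxpos _ hm
  have hpres2 : ∀ l : List E, (∀ a ∈ l, a ∈ Φs) → ∀ γ ∈ Δl, 0 < ⟪x, γ⟫ →
      (l.map rrefl).prod γ ∈ Δl ∧ 0 < ⟪x, (l.map rrefl).prod γ⟫ := by
    intro l
    induction l with
    | nil => intro _ γ hγ hp; simpa using ⟨hγ, hp⟩
    | cons a t ih =>
      intro hl γ hγ hp
      obtain ⟨h1, h2⟩ := ih (fun b hb => hl b (by simp [hb])) γ hγ hp
      have ha := hl a (by simp)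
      simp only [List.map_cons, List.prod_cons, LinearIsometryEquiv.coe_mul, Function.comp]
      exact ⟨hlr a (hΦΔ a (hΦsΦ a ha)) _ h1, hpres1 a ha _ h1 h2⟩
  -- inner products of short simple roots
  have hind : LinearIndependent ℝ (fun a : Φs => (a : E)) :=
    LinearIndepOn.mono (s := Φ) (v := id) hΦind hΦsΦ
  have hk : 0 < ls ^ 2 := by positivity
  have hself : ∀ a ∈ Φs, ⟪a, a⟫ = ls ^ 2 := fun a ha => by
    rw [real_inner_self_eq_norm_sq, hsn a (hΦsS a ha)]
  have hsubnot : ∀ a ∈ Φ, ∀ b ∈ Φ, a ≠ b → a - b ∉ Δp := by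
    intro a ha b hb hab hmem
    obtain ⟨y, hy⟩ := exists_dual hΦind (fun β => if β = b then 1 else 0)
    have hyn : ∀ β ∈ Φ, 0 ≤ ⟪y, β⟫ := fun β hβ => by rw [hy β hβ]; split_ifs <;> norm_num
    have := hnonneg y hyn _ hmem
    rw [inner_sub_right, hy a ha, hy b hb] at this
    simp [hab] at this
    norm_num at this
  have hoff : ∀ a ∈ Φs, ∀ b ∈ Φs, a ≠ b → ⟪a, b⟫ = 0 ∨ ⟪a, b⟫ = -(ls ^ 2 / 2) := by
    intro a ha b hb hab
    have hne' : b ≠ -a := by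
      intro e
      have h1 := hxpos b (hΦp (hΦsΦ b hb))
      have h2 := hxpos a (hΦp (hΦsΦ a ha))
      rw [e, inner_neg_right] at h1
      linarith
    have := root_mult h0ls hsn (fun α hα β hβ => hcrys α (hsΔ α hα) β (hsΔ β hβ))
      (hΦsS b hb) (hΦsS a ha) hab.symm hne'
    have hbb := hself b hb
    rcases this with h1 | h1 | h1
    · left
      rw [hbb, div_eq_iff hk.ne'] at h1
      linarith
    · exfalso
      have h2 := hrefl b (hΦΔ b (hΦsΦ b hb)) a (hΦΔ a (hΦsΦ a ha))
      rw [rrefl_apply, h1, one_smul] at h2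
      have h3 := hsubnot a (hΦsΦ a ha) b (hΦsΦ b hb) hab
      have h4 := hsubnot b (hΦsΦ b hb) a (hΦsΦ a ha) hab.symm
      rw [← neg_sub a b] at h4
      exact h3 ((hpm _ h2).2 h4)
    · right
      rw [hbb, div_eq_iff hk.ne'] at h1
      linarith
  -- the factorization
  obtain ⟨m, hmnd, hm, c₂, hc₂, hfac⟩ := factor (Φ := Φ) hrefl hΔl hcover lΦ hlnd
    (fun a ha => hΦΔ a ((hmΦ a).1 ha))
  have hmm : ∀ a, a ∈ m ↔ a ∈ Φs := fun a => by rw [hm, hmΦ, hΦs]; rfl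
  have hconj : IsConj (m.map rrefl).prod (lΦs.map rrefl).prod := by
    refine CE.isConj (C := fun a b => ⟪a, b⟫ = 0) rrefl (fun a b hab => rrefl_comm hab) ?_
    refine CE.of_perm _ _ _ rfl hmnd ?_ ?_
    · rw [List.perm_ext_iff_of_nodup hmnd hlnds]
      intro a
      rw [hmm, hmΦs]
    · intro s _ hs0 hsub
      have := exists_leaf hk hind hself hoff s.toFinset
        (by simpa [List.toFinset_nonempty_iff] using hs0)
        (fun a ha => (hmm a).1 (hsub a (by simpa using ha)))
      simpa using this
  have hord : orderOf (m.map rrefl).prod = hs := by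
    rw [hcoxs]
    obtain ⟨g, hg⟩ := isConj_iff.1 hconj
    rw [← hg]
    exact (orderOf_injective (MulAut.conj g).toMonoidHom (MulAut.conj g).injective
      (m.map rrefl).prod).symm
  have hmΔ : ∀ a ∈ m, a ∈ Δ := fun a ha => hΦΔ a (hΦsΦ a ((hmm a).1 ha))
  have hnrm := norm_step hrefl hΔl m hmΔ
  refine ⟨⟨_, c₂, ⟨m, hmnd, Set.ext hmm, rfl⟩, hc₂, hfac⟩, ?_, ?_⟩
  · obtain ⟨e, he, h1⟩ := pow_factor hc₂ hnrm hs
    rw [hfac, h1, ← hord, pow_orderOf_eq_one, one_mul]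
    exact he
  · obtain ⟨e, he, h1⟩ := pow_factor hc₂ hnrm h
    rw [← hfac, hcox, pow_orderOf_eq_one, ← hcox] at h1
    have h2 : (m.map rrefl).prod ^ h ∈ weylOf Δl := by
      rw [eq_inv_of_mul_eq_one_left h1.symm]
      exact inv_mem he
    rw [← hord]
    apply orderOf_dvd_of_pow_eq_one
    have hlfin : Δl.Finite := hfin.subset hlΔ
    refine trivial_of_pres hlfin (h0ls.trans hlsll) hln
      (fun α hα β hβ => hcrys α (hlΔ α hα) β (hlΔ β hβ))
      (fun α hα β hβ => hlr α (hlΔ α hα) β hβ) x (fun γ hγ => hxne γ (hlΔ γ hγ)) h2 ?_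
    have hpw : ∀ n : ℕ, ∀ γ ∈ Δl, 0 < ⟪x, γ⟫ → ((m.map rrefl).prod ^ n) γ ∈ Δl ∧
        0 < ⟪x, ((m.map rrefl).prod ^ n) γ⟫ := by
      intro n
      induction n with
      | zero => intro γ hγ hp; simpa using ⟨hγ, hp⟩
      | succ n ih =>
        intro γ hγ hp
        obtain ⟨h1, h2⟩ := ih γ hγ hp
        rw [pow_succ', LinearIsometryEquiv.coe_mul, Function.comp_apply]
        exact hpres2 m (fun a ha => (hmm a).1 ha) _ h1 h2
    exact fun γ hγ hp => (hpw h γ hγ hp).2
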